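/- arXiv:0704.3110 — 2 statements merged into one kernel-verified Lean document; each statement's English description precedes it below -/
import Mathlib

section
/- Let P : [0,∞) → ℝ be C¹, let h be C¹ on (0,∞) with h'(r) = P'(r)/r for r > 0, and let g(ρ) = ∫₀^ρ h(r) dr. Let (ρ, u) be a classical solution of the 1D QHD system on [0,1]×[0,T] satisfying ρ_x(0,t) = ρ_x(1,t) = 0 for all t ∈ [0,T]. Define the energy E(t) = ∫₀¹ [½ ρu² + g(ρ) + ((√ρ)_x)²](x,t) dx and K(x,t) = ½u² + h(ρ) − (√ρ)_xx/√ρ. Then for every t ∈ [0,T]: E(t) − E(0) + ∫₀ᵗ [(uρK)(1,s) − (uρK)(0,s)] ds = 0. -/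
open MeasureTheory Real Set

/-- Partial derivative in the first (space) variable. -/
noncomputable def pdx (f : ℝ → ℝ → ℝ) (x t : ℝ) : ℝ := deriv (fun y => f y t) x

/-- Partial derivative in the second (time) variable. -/
noncomputable def pdt (f : ℝ → ℝ → ℝ) (x t : ℝ) : ℝ := deriv (fun s => f x s) t

/-- Pointwise square root of a function of `(x, t)`. -/
noncomputable def sqf (ρ : ℝ → ℝ → ℝ) (x t : ℝ) : ℝ := Real.sqrt (ρ x t)

/-- A classical solution of the one-dimensional quantum hydrodynamic system (with ε² = 2)
`ρ_t + (ρu)_x = 0`, `(ρu)_t + (ρu² + P(ρ))_x = ρ·((√ρ)_xx/√ρ)_x` on `[0,1] × [0,T]`: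
`ρ > 0`, `ρ` of class `C¹` in `t` and `C³` in `x`, `u` of class `C¹` in `t` and `C²` in `x`,
all derivatives jointly continuous, and both equations hold pointwise. -/
structure IsQHDSolution1D (P : ℝ → ℝ) (ρ u : ℝ → ℝ → ℝ) (T : ℝ) : Prop where
  pos : ∀ x ∈ Set.Icc (0:ℝ) 1, ∀ t ∈ Set.Icc (0:ℝ) T, 0 < ρ x t
  rho_C3_x : ∀ t ∈ Set.Icc (0:ℝ) T, ContDiff ℝ 3 (fun x => ρ x t)
  rho_C1_t : ∀ x ∈ Set.Icc (0:ℝ) 1, ContDiff ℝ 1 (fun t => ρ x t)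
  u_C2_x : ∀ t ∈ Set.Icc (0:ℝ) T, ContDiff ℝ 2 (fun x => u x t)
  u_C1_t : ∀ x ∈ Set.Icc (0:ℝ) 1, ContDiff ℝ 1 (fun t => u x t)
  rho_cont : Continuous fun p : ℝ × ℝ => ρ p.1 p.2
  u_cont : Continuous fun p : ℝ × ℝ => u p.1 p.2
  rho_t_cont : Continuous fun p : ℝ × ℝ => pdt ρ p.1 p.2
  rho_x_cont : Continuous fun p : ℝ × ℝ => pdx ρ p.1 p.2
  rho_xx_cont : Continuous fun p : ℝ × ℝ => pdx (pdx ρ) p.1 p.2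
  rho_xxx_cont : Continuous fun p : ℝ × ℝ => pdx (pdx (pdx ρ)) p.1 p.2
  u_t_cont : Continuous fun p : ℝ × ℝ => pdt u p.1 p.2
  u_x_cont : Continuous fun p : ℝ × ℝ => pdx u p.1 p.2
  u_xx_cont : Continuous fun p : ℝ × ℝ => pdx (pdx u) p.1 p.2
  mass : ∀ x ∈ Set.Icc (0:ℝ) 1, ∀ t ∈ Set.Icc (0:ℝ) T,
    pdt ρ x t + pdx (fun y s => ρ y s * u y s) x t = 0
  momentum : ∀ x ∈ Set.Icc (0:ℝ) 1, ∀ t ∈ Set.Icc (0:ℝ) T,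
    pdt (fun y s => ρ y s * u y s) x t
      + pdx (fun y s => ρ y s * u y s ^ 2 + P (ρ y s)) x t
      = ρ x t * pdx (fun y s => pdx (pdx (sqf ρ)) y s / sqf ρ y s) x t

theorem intervalIntegral_swap_of_continuousOn {f : ℝ → ℝ → ℝ} {a b c d : ℝ}
    (hf : ContinuousOn (fun p : ℝ × ℝ => f p.1 p.2) (uIcc a b ×ˢ uIcc c d)) :
    ∫ x in a..b, ∫ y in c..d, f x y = ∫ y in c..d, ∫ x in a..b, f x y := by
  refine intervalIntegral_intervalIntegral_swap ?_
  exact (hf.integrableOn_compact (isCompact_uIcc.prod isCompact_uIcc)).mono_set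
    (prod_mono uIoc_subset_uIcc uIoc_subset_uIcc)

/-- Integrated form of a local conservation law `e_t + F_x = 0` on a rectangle. -/
theorem integral_conservation_law {e f F : ℝ → ℝ → ℝ} {a b t₀ t₁ : ℝ}
    (hab : a ≤ b) (ht : t₀ ≤ t₁)
    (hf : ContinuousOn (fun p : ℝ × ℝ => f p.1 p.2) (Icc a b ×ˢ Icc t₀ t₁))
    (he : ContinuousOn (fun p : ℝ × ℝ => e p.1 p.2) (Icc a b ×ˢ Icc t₀ t₁))
    (het : ∀ x ∈ Icc a b, ∀ t ∈ Ioo t₀ t₁, HasDerivAt (fun s => e x s) (-f x t) t)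
    (hFx : ∀ t ∈ Icc t₀ t₁, ∀ x ∈ Icc a b, HasDerivAt (fun y => F y t) (f x t) x) :
    (∫ x in a..b, e x t₁) - (∫ x in a..b, e x t₀)
      + ∫ t in t₀..t₁, (F b t - F a t) = 0 := by
  have slice_x : ∀ {k : ℝ → ℝ → ℝ},
      ContinuousOn (fun p : ℝ × ℝ => k p.1 p.2) (Icc a b ×ˢ Icc t₀ t₁) →
      ∀ t ∈ Icc t₀ t₁, ContinuousOn (fun x => k x t) (Icc a b) := fun hk t ht' =>
    hk.comp (f := fun x : ℝ => (x, t)) (by fun_prop) fun x hx => ⟨hx, ht'⟩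
  have slice_t : ∀ {k : ℝ → ℝ → ℝ},
      ContinuousOn (fun p : ℝ × ℝ => k p.1 p.2) (Icc a b ×ˢ Icc t₀ t₁) →
      ∀ x ∈ Icc a b, ContinuousOn (fun t => k x t) (Icc t₀ t₁) := fun hk x hx =>
    hk.comp (f := fun t : ℝ => (x, t)) (by fun_prop) fun t ht' => ⟨hx, ht'⟩
  rw [← intervalIntegral.integral_sub
    ((slice_x he t₁ (right_mem_Icc.2 ht)).intervalIntegrable_of_Icc hab)
    ((slice_x he t₀ (left_mem_Icc.2 ht)).intervalIntegrable_of_Icc hab)]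
  have h1 : ∫ x in a..b, (e x t₁ - e x t₀) = ∫ x in a..b, ∫ t in t₀..t₁, -f x t := by
    refine intervalIntegral.integral_congr fun x hx => ?_
    rw [uIcc_of_le hab] at hx
    exact (intervalIntegral.integral_eq_sub_of_hasDerivAt_of_le ht (slice_t he x hx)
      (het x hx) ((slice_t hf x hx).neg.intervalIntegrable_of_Icc ht)).symm
  have h2 : ∫ t in t₀..t₁, (F b t - F a t) = ∫ t in t₀..t₁, ∫ x in a..b, f x t := by
    refine intervalIntegral.integral_congr fun t ht' => ?_
    rw [uIcc_of_le ht] at ht'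
    refine (intervalIntegral.integral_eq_sub_of_hasDerivAt (f := fun y => F y t) (fun x hx => ?_)
      ((slice_x hf t ht').intervalIntegrable_of_Icc hab)).symm
    rw [uIcc_of_le hab] at hx
    exact hFx t ht' x hx
  rw [h1, h2, ← intervalIntegral_swap_of_continuousOn (f := f)
    (by rwa [uIcc_of_le hab, uIcc_of_le ht])]
  simp [intervalIntegral.integral_neg]

theorem hasDerivAt_intervalIntegral_of_continuous {a b : ℝ → ℝ → ℝ} {t₀ t₁ : ℝ} (ht : t₀ ≤ t₁)
    (ha : Continuous fun p : ℝ × ℝ => a p.1 p.2) (hb : Continuous fun p : ℝ × ℝ => b p.1 p.2)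
    (hab : ∀ t ∈ Icc t₀ t₁, ∀ x, HasDerivAt (fun y => a y t) (b x t) x) (x : ℝ) :
    HasDerivAt (fun y => ∫ t in t₀..t₁, a y t) (∫ t in t₀..t₁, b x t) x := by
  have hB : Continuous fun y => ∫ t in t₀..t₁, b y t :=
    intervalIntegral.continuous_parametric_intervalIntegral_of_continuous' hb t₀ t₁
  have key : (fun y => ∫ t in t₀..t₁, a y t)
      = fun y => (∫ t in t₀..t₁, a 0 t) + ∫ z in (0:ℝ)..y, ∫ t in t₀..t₁, b z t := by
    funext y
    rw [intervalIntegral_swap_of_continuousOn hb.continuousOn,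
      ← intervalIntegral.integral_add]
    · refine intervalIntegral.integral_congr fun t ht' => ?_
      rw [uIcc_of_le ht] at ht'
      have := intervalIntegral.integral_eq_sub_of_hasDerivAt (a := 0) (b := y)
        (fun z _ => hab t ht' z)
        (Continuous.intervalIntegrable (hb.comp (by fun_prop : Continuous fun z => (z, t))) _ _)
      simp only [this]
      ring
    · exact Continuous.intervalIntegrable (ha.comp (by fun_prop : Continuous fun t => ((0:ℝ), t)))
        _ _
    · refine Continuous.intervalIntegrable ?_ _ _
      exact intervalIntegral.continuous_parametric_intervalIntegral_of_continuous'
        (f := fun t z => b z t) (hb.comp (by fun_prop : Continuous fun p : ℝ × ℝ => (p.2, p.1))) 0 y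
  rw [key]
  exact (intervalIntegral.integral_hasDerivAt_right (hB.intervalIntegrable _ _)
    (hB.stronglyMeasurableAtFilter _ _) hB.continuousAt).const_add _

/-- If `r_t = a` and `a_x = b` with `a`, `b` continuous, then `(r_x)_t = b`. -/
theorem hasDerivAt_mixed_partial {r r₁ a b : ℝ → ℝ → ℝ} {x₀ x₁ T : ℝ} (hx₀₁ : x₀ < x₁)
    (ha : Continuous fun p : ℝ × ℝ => a p.1 p.2) (hb : Continuous fun p : ℝ × ℝ => b p.1 p.2)
    (hrt : ∀ x ∈ Icc x₀ x₁, ∀ t ∈ Icc 0 T, HasDerivAt (fun s => r x s) (a x t) t)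
    (hrx : ∀ x ∈ Icc x₀ x₁, ∀ t ∈ Icc 0 T, HasDerivAt (fun y => r y t) (r₁ x t) x)
    (hab : ∀ t ∈ Icc 0 T, ∀ x, HasDerivAt (fun y => a y t) (b x t) x)
    {x t : ℝ} (hx : x ∈ Icc x₀ x₁) (ht : t ∈ Ioo 0 T) :
    HasDerivAt (fun s => r₁ x s) (b x t) t := by
  have key : ∀ s ∈ Icc 0 T, r₁ x s = r₁ x 0 + ∫ τ in (0:ℝ)..s, b x τ := by
    intro s hs
    have h0 : (0:ℝ) ∈ Icc 0 T := ⟨le_rfl, hs.1.trans hs.2⟩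
    have hsub : ∀ τ ∈ Icc 0 s, τ ∈ Icc 0 T := fun τ hτ => ⟨hτ.1, hτ.2.trans hs.2⟩
    have hD := hasDerivAt_intervalIntegral_of_continuous hs.1 ha hb
      (fun τ hτ => hab τ (hsub τ hτ)) x
    have hr : ∀ y ∈ Icc x₀ x₁, r y s = r y 0 + ∫ τ in (0:ℝ)..s, a y τ := by
      intro y hy
      rw [intervalIntegral.integral_eq_sub_of_hasDerivAt (f := fun τ => r y τ)
        (f' := fun τ => a y τ) (fun τ hτ => ?_)
        (Continuous.intervalIntegrable (ha.comp (by fun_prop : Continuous fun τ => (y, τ))) _ _)]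
      · ring
      · rw [uIcc_of_le hs.1] at hτ
        exact hrt y hy τ (hsub τ hτ)
    have h2 : HasDerivWithinAt (fun y => r y s) (r₁ x 0 + ∫ τ in (0:ℝ)..s, b x τ)
        (Icc x₀ x₁) x :=
      ((hrx x hx 0 h0).add hD).hasDerivWithinAt.congr hr (hr x hx)
    exact (uniqueDiffOn_Icc hx₀₁ x hx).eq_deriv _ (hrx x hx s hs).hasDerivWithinAt h2
  have hbx : Continuous fun τ => b x τ := hb.comp (by fun_prop : Continuous fun τ => (x, τ))
  have hI : HasDerivAt (fun s => r₁ x 0 + ∫ τ in (0:ℝ)..s, b x τ) (b x t) t :=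
    (intervalIntegral.integral_hasDerivAt_right (hbx.intervalIntegrable _ _)
      (hbx.stronglyMeasurableAtFilter _ _) hbx.continuousAt).const_add _
  exact hI.congr_of_eventuallyEq
    (Filter.eventually_of_mem (Icc_mem_nhds ht.1 ht.2) key)

/-- The enthalpy `h` of a `C¹` pressure has at most a logarithmic singularity at vacuum. -/
theorem intervalIntegrable_enthalpy {P h : ℝ → ℝ} (hP : ContDiffOn ℝ 1 P (Ici 0))
    (hh : ContDiffOn ℝ 1 h (Ioi 0)) (hh' : ∀ r > (0:ℝ), deriv h r = deriv P r / r)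
    {r : ℝ} (hr : 0 < r) : IntervalIntegrable h volume 0 r := by
  obtain ⟨M, hM⟩ := (isCompact_Icc (a := 0) (b := r)).exists_bound_of_continuousOn
    (((contDiffOn_one_iff_derivWithin (uniqueDiffOn_Ici 0)).1 hP).2.mono Icc_subset_Ici_self)
  have hPd : ∀ s ∈ Ioo 0 r, |deriv P s| ≤ M := fun s hs => by
    have := hM s ⟨hs.1.le, hs.2.le⟩
    rwa [derivWithin_of_mem_nhds (Ici_mem_nhds hs.1)] at this
  have hd : ∀ s, 0 < s → HasDerivAt h (deriv P s / s) s := fun s hs => by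
    rw [← hh' s hs]
    exact ((hh.differentiableOn one_ne_zero).differentiableAt (Ioi_mem_nhds hs)).hasDerivAt
  have hmono : ∀ c : ℝ, |c| = 1 → MonotoneOn (fun s => c * h s + M * log s) (Ioc 0 r) := by
    intro c hc
    have hder : ∀ s, 0 < s → HasDerivAt (fun s => c * h s + M * log s)
        (c * (deriv P s / s) + M * s⁻¹) s := fun s hs =>
      ((hd s hs).const_mul c).add ((hasDerivAt_log hs.ne').const_mul M)
    refine monotoneOn_of_deriv_nonneg (convex_Ioc 0 r)
      (fun s hs => (hder s hs.1).continuousAt.continuousWithinAt) ?_ ?_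
    · rw [interior_Ioc]
      exact fun s hs => (hder s hs.1).differentiableAt.differentiableWithinAt
    · rw [interior_Ioc]
      intro s hs
      rw [(hder s hs.1).deriv]
      have h1 : |c * deriv P s| ≤ M := by rw [abs_mul, hc, one_mul]; exact hPd s hs
      have h2 := (abs_le.1 h1).1
      have : c * (deriv P s / s) + M * s⁻¹ = (c * deriv P s + M) / s := by
        field_simp
      rw [this]
      exact div_nonneg (by linarith) hs.1.le
  have hbound : IntegrableOn (fun s => |h r| + M * log r - M * log s) (Ioc 0 r) := by
    refine (intervalIntegrable_iff_integrableOn_Ioc_of_le hr.le).1 ?_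
    exact intervalIntegrable_const.sub (intervalIntegral.intervalIntegrable_log'.const_mul M)
  refine (intervalIntegrable_iff_integrableOn_Ioc_of_le hr.le).2 (hbound.mono' ?_ ?_)
  · exact (hh.continuousOn.mono fun s hs => hs.1).aestronglyMeasurable measurableSet_Ioc
  · refine (ae_restrict_iff' measurableSet_Ioc).2 (Filter.Eventually.of_forall fun s hs => ?_)
    have h1 := hmono 1 (by simp) hs ⟨hr, le_rfl⟩ hs.2
    have h2 := hmono (-1) (by simp) hs ⟨hr, le_rfl⟩ hs.2
    have h3 := le_abs_self (h r)
    have h4 := neg_abs_le (h r)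
    simp only at h1 h2
    rw [Real.norm_eq_abs, abs_le]
    constructor <;> linarith

theorem hasDerivAt_primitive_enthalpy {P h g : ℝ → ℝ} (hP : ContDiffOn ℝ 1 P (Ici 0))
    (hh : ContDiffOn ℝ 1 h (Ioi 0)) (hh' : ∀ r > (0:ℝ), deriv h r = deriv P r / r)
    (hg : ∀ r : ℝ, g r = ∫ s in (0:ℝ)..r, h s) {r : ℝ} (hr : 0 < r) :
    HasDerivAt g (h r) r := by
  rw [funext hg]
  exact intervalIntegral.integral_hasDerivAt_right (intervalIntegrable_enthalpy hP hh hh' hr)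
    (hh.continuousOn.stronglyMeasurableAtFilter isOpen_Ioi r hr)
    (hh.continuousOn.continuousAt (Ioi_mem_nhds hr))

/-- The first derivative of `√r`, and the quantum potential `(√r)_xx / √r`, in terms of `r`. -/
theorem deriv_sqrt_quantum_potential {r r₁ r₂ : ℝ → ℝ} (h₁ : ∀ x, HasDerivAt r (r₁ x) x)
    (h₂ : ∀ x, HasDerivAt r₁ (r₂ x) x) {x : ℝ} (hx : 0 < r x) :
    deriv (fun y => √(r y)) x = r₁ x / (2 * √(r x)) ∧
      deriv (deriv fun y => √(r y)) x / √(r x)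
        = r₂ x / (2 * r x) - r₁ x ^ 2 / (4 * r x ^ 2) := by
  have hd : ∀ y, 0 < r y → HasDerivAt (fun y => √(r y)) (r₁ y / (2 * √(r y))) y :=
    fun y hy => (h₁ y).sqrt hy.ne'
  refine ⟨(hd x hx).deriv, ?_⟩
  have hev : deriv (fun y => √(r y)) =ᶠ[nhds x] fun y => r₁ y / (2 * √(r y)) := by
    filter_upwards [(h₁ x).continuousAt.eventually (lt_mem_nhds hx)] with y hy
    exact (hd y hy).deriv
  have hs : 0 < √(r x) := Real.sqrt_pos.2 hx
  rw [hev.deriv_eq, ((h₂ x).fun_div ((hd x hx).const_mul 2) (by positivity)).deriv]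
  have hsq : r x = √(r x) ^ 2 := (Real.sq_sqrt hx.le).symm
  generalize √(r x) = w at *
  rw [hsq]
  field_simp
  ring

/-- Energy identity for the 1D QHD system with Neumann boundary conditions for `ρ`:
`E(t) − E(0) + ∫₀ᵗ [(uρK)(1,s) − (uρK)(0,s)] ds = 0`, where
`E(t) = ∫₀¹ [½ρu² + g(ρ) + ((√ρ)_x)²] dx` and `K = ½u² + h(ρ) − (√ρ)_xx/√ρ`. -/
theorem qhd1d_energy_identity
    (P h : ℝ → ℝ) (hP : ContDiffOn ℝ 1 P (Set.Ici 0))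
    (hh : ContDiffOn ℝ 1 h (Set.Ioi 0))
    (hh' : ∀ r > (0:ℝ), deriv h r = deriv P r / r)
    (g : ℝ → ℝ) (hg : ∀ r : ℝ, g r = ∫ s in (0:ℝ)..r, h s)
    (T : ℝ) (hT : 0 ≤ T) (ρ u : ℝ → ℝ → ℝ)
    (hsol : IsQHDSolution1D P ρ u T)
    (hNeumann : ∀ t ∈ Set.Icc (0:ℝ) T, pdx ρ 0 t = 0 ∧ pdx ρ 1 t = 0)
    (E : ℝ → ℝ)
    (hE : ∀ t : ℝ, E t = ∫ x in (0:ℝ)..1,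
      (ρ x t * u x t ^ 2 / 2 + g (ρ x t) + (pdx (sqf ρ) x t) ^ 2))
    (K : ℝ → ℝ → ℝ)
    (hK : ∀ x t : ℝ, K x t = u x t ^ 2 / 2 + h (ρ x t) - pdx (pdx (sqf ρ)) x t / sqf ρ x t) :
    ∀ t ∈ Set.Icc (0:ℝ) T,
      E t - E 0 + ∫ s in (0:ℝ)..t, (u 1 s * ρ 1 s * K 1 s - u 0 s * ρ 0 s * K 0 s) = 0 := by
  intro t ht
  have hsub : ∀ s ∈ Icc 0 t, s ∈ Icc 0 T := fun s hs => ⟨hs.1, hs.2.trans ht.2⟩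
  have hpos := hsol.pos
  -- spatial derivatives
  have hρx : ∀ s ∈ Icc 0 T, ∀ x, HasDerivAt (fun y => ρ y s) (pdx ρ x s) x := fun s hs x =>
    ((hsol.rho_C3_x s hs).differentiable (by norm_num) x).hasDerivAt
  have hρ2 : ∀ s ∈ Icc 0 T, ContDiff ℝ 2 (fun y => pdx ρ y s) := fun s hs =>
    (contDiff_succ_iff_deriv (n := 2).1 (hsol.rho_C3_x s hs)).2.2
  have hρxx : ∀ s ∈ Icc 0 T, ∀ x, HasDerivAt (fun y => pdx ρ y s) (pdx (pdx ρ) x s) x :=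
    fun s hs x => ((hρ2 s hs).differentiable (by norm_num) x).hasDerivAt
  have hρ3 : ∀ s ∈ Icc 0 T, ContDiff ℝ 1 (fun y => pdx (pdx ρ) y s) := fun s hs =>
    (contDiff_succ_iff_deriv (n := 1).1 (hρ2 s hs)).2.2
  have hρxxx : ∀ s ∈ Icc 0 T, ∀ x,
      HasDerivAt (fun y => pdx (pdx ρ) y s) (pdx (pdx (pdx ρ)) x s) x :=
    fun s hs x => ((hρ3 s hs).differentiable (by norm_num) x).hasDerivAt
  have hux : ∀ s ∈ Icc 0 T, ∀ x, HasDerivAt (fun y => u y s) (pdx u x s) x := fun s hs x =>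
    ((hsol.u_C2_x s hs).differentiable (by norm_num) x).hasDerivAt
  have hu2 : ∀ s ∈ Icc 0 T, ContDiff ℝ 1 (fun y => pdx u y s) := fun s hs =>
    (contDiff_succ_iff_deriv (n := 1).1 (hsol.u_C2_x s hs)).2.2
  have huxx : ∀ s ∈ Icc 0 T, ∀ x, HasDerivAt (fun y => pdx u y s) (pdx (pdx u) x s) x :=
    fun s hs x => ((hu2 s hs).differentiable (by norm_num) x).hasDerivAt
  -- time derivatives
  have hρt : ∀ x ∈ Icc (0:ℝ) 1, ∀ s, HasDerivAt (fun τ => ρ x τ) (pdt ρ x s) s := fun x hx s =>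
    ((hsol.rho_C1_t x hx).differentiable (by norm_num) s).hasDerivAt
  have hut : ∀ x ∈ Icc (0:ℝ) 1, ∀ s, HasDerivAt (fun τ => u x τ) (pdt u x s) s := fun x hx s =>
    ((hsol.u_C1_t x hx).differentiable (by norm_num) s).hasDerivAt
  -- enthalpy and pressure
  have hhd : ∀ r, 0 < r → HasDerivAt h (deriv P r / r) r := fun r hr => by
    rw [← hh' r hr]
    exact ((hh.differentiableOn one_ne_zero).differentiableAt (Ioi_mem_nhds hr)).hasDerivAt
  have hPd : ∀ r, 0 < r → HasDerivAt P (deriv P r) r := fun r hr =>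
    ((hP.differentiableOn one_ne_zero).differentiableAt (Ici_mem_nhds hr)).hasDerivAt
  have hgd : ∀ r, 0 < r → HasDerivAt g (h r) r := fun r hr =>
    hasDerivAt_primitive_enthalpy hP hh hh' hg hr
  -- the mass flux and its space derivatives
  obtain ⟨a, ha⟩ : ∃ a : ℝ → ℝ → ℝ, ∀ x s, a x s = pdx ρ x s * u x s + ρ x s * pdx u x s :=
    ⟨_, fun _ _ => rfl⟩
  obtain ⟨b, hb⟩ : ∃ b : ℝ → ℝ → ℝ, ∀ x s, b x s = pdx (pdx ρ) x s * u x s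
      + pdx ρ x s * pdx u x s + (pdx ρ x s * pdx u x s + ρ x s * pdx (pdx u) x s) :=
    ⟨_, fun _ _ => rfl⟩
  have hac : Continuous fun p : ℝ × ℝ => a p.1 p.2 := by
    simp only [ha]
    exact (hsol.rho_x_cont.mul hsol.u_cont).add (hsol.rho_cont.mul hsol.u_x_cont)
  have hbc : Continuous fun p : ℝ × ℝ => b p.1 p.2 := by
    simp only [hb]
    exact ((hsol.rho_xx_cont.mul hsol.u_cont).add (hsol.rho_x_cont.mul hsol.u_x_cont)).add
      ((hsol.rho_x_cont.mul hsol.u_x_cont).add (hsol.rho_cont.mul hsol.u_xx_cont))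
  have hax : ∀ s ∈ Icc 0 T, ∀ x, HasDerivAt (fun y => a y s) (b x s) x := fun s hs x => by
    simp only [ha, hb]
    exact ((hρxx s hs x).mul (hux s hs x)).add ((hρx s hs x).mul (huxx s hs x))
  have hmass : ∀ x ∈ Icc (0:ℝ) 1, ∀ s ∈ Icc 0 T, pdt ρ x s = -a x s := fun x hx s hs => by
    have h1 := hsol.mass x hx s hs
    have h2 : pdx (fun y s => ρ y s * u y s) x s = a x s := by
      rw [ha]
      exact ((hρx s hs x).mul (hux s hs x)).deriv
    linarith
  have hρxt : ∀ x ∈ Icc (0:ℝ) 1, ∀ s ∈ Ioo 0 T,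
      HasDerivAt (fun τ => pdx ρ x τ) (-b x s) s := fun x hx s hs =>
    hasDerivAt_mixed_partial (r := ρ) (a := fun x s => -a x s) (b := fun x s => -b x s)
      zero_lt_one hac.neg hbc.neg
      (fun y hy τ hτ => by rw [← hmass y hy τ hτ]; exact hρt y hy τ)
      (fun y _ τ hτ => hρx τ hτ y) (fun τ hτ y => (hax τ hτ y).neg) hx hs
  -- the quantum potential
  obtain ⟨Q, hQ⟩ : ∃ Q : ℝ → ℝ → ℝ, ∀ x s, Q x s =
      pdx (pdx ρ) x s / (2 * ρ x s) - pdx ρ x s ^ 2 / (4 * ρ x s ^ 2) := ⟨_, fun _ _ => rfl⟩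
  obtain ⟨Q₁, hQ₁⟩ : ∃ Q₁ : ℝ → ℝ → ℝ, ∀ x s, Q₁ x s =
      pdx (pdx (pdx ρ)) x s / (2 * ρ x s) - pdx ρ x s * pdx (pdx ρ) x s / ρ x s ^ 2
        + pdx ρ x s ^ 3 / (2 * ρ x s ^ 3) := ⟨_, fun _ _ => rfl⟩
  have hsq : ∀ s ∈ Icc 0 T, ∀ x, 0 < ρ x s →
      pdx (sqf ρ) x s ^ 2 = pdx ρ x s ^ 2 / (4 * ρ x s) ∧
        pdx (pdx (sqf ρ)) x s / sqf ρ x s = Q x s := fun s hs x hx => by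
    obtain ⟨h1, h2⟩ := deriv_sqrt_quantum_potential (hρx s hs) (hρxx s hs) hx
    refine ⟨?_, h2.trans (hQ x s).symm⟩
    have h3 : pdx (sqf ρ) x s = pdx ρ x s / (2 * √(ρ x s)) := h1
    rw [h3, div_pow, mul_pow, Real.sq_sqrt hx.le]
    norm_num
  have hQx : ∀ s ∈ Icc 0 T, ∀ x, 0 < ρ x s → HasDerivAt (fun y => Q y s) (Q₁ x s) x := by
    intro s hs x hx
    simp only [hQ, hQ₁]
    refine HasDerivAt.congr_deriv
      (((hρxxx s hs x).fun_div ((hρx s hs x).const_mul 2) (by positivity)).sub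
      (((hρxx s hs x).fun_pow 2).fun_div (((hρx s hs x).fun_pow 2).const_mul 4) (by positivity))) ?_
    field_simp
    ring
  have hmom : ∀ x ∈ Icc (0:ℝ) 1, ∀ s ∈ Icc 0 T,
      ρ x s * pdt u x s = -(ρ x s * u x s * pdx u x s) - deriv P (ρ x s) * pdx ρ x s
        + ρ x s * Q₁ x s := by
    intro x hx s hs
    have hp := hpos x hx s hs
    have h0 := hsol.momentum x hx s hs
    have h1 : pdt (fun y s => ρ y s * u y s) x s = pdt ρ x s * u x s + ρ x s * pdt u x s :=
      ((hρt x hx s).mul (hut x hx s)).deriv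
    have h2 : pdx (fun y s => ρ y s * u y s ^ 2 + P (ρ y s)) x s
        = pdx ρ x s * u x s ^ 2 + ρ x s * (2 * u x s * pdx u x s)
          + deriv P (ρ x s) * pdx ρ x s := by
      have := ((hρx s hs x).mul ((hux s hs x).fun_pow 2)).add
        ((hPd _ hp).comp x (hρx s hs x))
      refine this.deriv.trans ?_
      norm_num
    have h3 : pdx (fun y s => pdx (pdx (sqf ρ)) y s / sqf ρ y s) x s = Q₁ x s := by
      refine HasDerivAt.deriv ((hQx s hs x hp).congr_of_eventuallyEq ?_)
      filter_upwards [(hρx s hs x).continuousAt.eventually (lt_mem_nhds hp)] with y hy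
      exact (hsq s hs y hy).2
    rw [h1, h2, h3, hmass x hx s hs, ha] at h0
    linear_combination h0
  -- energy density, its time derivative and its flux
  obtain ⟨f, hf⟩ : ∃ f : ℝ → ℝ → ℝ, ∀ x s, f x s =
      a x s * u x s ^ 2 / 2 - ρ x s * u x s * pdt u x s + h (ρ x s) * a x s
        + pdx ρ x s * b x s / (2 * ρ x s) - pdx ρ x s ^ 2 * a x s / (4 * ρ x s ^ 2) :=
    ⟨_, fun _ _ => rfl⟩
  have hcons := integral_conservation_law
    (e := fun x s => ρ x s * u x s ^ 2 / 2 + g (ρ x s) + pdx ρ x s ^ 2 / (4 * ρ x s)) (f := f)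
    (F := fun x s => ρ x s * u x s * (u x s ^ 2 / 2 + h (ρ x s) - Q x s)
      + pdx ρ x s * a x s / (2 * ρ x s))
    zero_le_one ht.1 ?_ ?_ ?_ ?_
  · have hEs : ∀ s ∈ Icc 0 T, E s = ∫ x in (0:ℝ)..1,
        (ρ x s * u x s ^ 2 / 2 + g (ρ x s) + pdx ρ x s ^ 2 / (4 * ρ x s)) := by
      intro s hs
      rw [hE]
      refine intervalIntegral.integral_congr fun x hx => ?_
      rw [uIcc_of_le zero_le_one] at hx
      simp only [(hsq s hs x (hpos x hx s hs)).1]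
    rw [hEs t ht, hEs 0 ⟨le_rfl, hT⟩]
    refine Eq.trans ?_ hcons
    congr 1
    refine intervalIntegral.integral_congr fun s hs => ?_
    rw [uIcc_of_le ht.1] at hs
    have hs' := hsub s hs
    simp only [hK, (hsq s hs' 1 (hpos 1 (by simp) s hs')).2,
      (hsq s hs' 0 (hpos 0 (by simp) s hs')).2, (hNeumann s hs').1, (hNeumann s hs').2]
    ring
  · simp only [hf]
    have hne : ∀ p ∈ Icc (0:ℝ) 1 ×ˢ Icc 0 t, 0 < ρ p.1 p.2 := fun p hp =>
      hpos _ hp.1 _ (hsub _ hp.2)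
    have hhc : ContinuousOn (fun p : ℝ × ℝ => h (ρ p.1 p.2)) (Icc (0:ℝ) 1 ×ˢ Icc 0 t) :=
      hh.continuousOn.comp hsol.rho_cont.continuousOn hne
    have c1 := hac.continuousOn (s := Icc (0:ℝ) 1 ×ˢ Icc 0 t)
    have c2 := hbc.continuousOn (s := Icc (0:ℝ) 1 ×ˢ Icc 0 t)
    have c3 := hsol.rho_cont.continuousOn (s := Icc (0:ℝ) 1 ×ˢ Icc 0 t)
    have c4 := hsol.u_cont.continuousOn (s := Icc (0:ℝ) 1 ×ˢ Icc 0 t)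
    have c5 := hsol.u_t_cont.continuousOn (s := Icc (0:ℝ) 1 ×ˢ Icc 0 t)
    have c6 := hsol.rho_x_cont.continuousOn (s := Icc (0:ℝ) 1 ×ˢ Icc 0 t)
    refine ((((((c1.mul (c4.pow 2)).div_const 2).sub ((c3.mul c4).mul c5)).add
      (hhc.mul c1))).add ((c6.mul c2).div (c3.const_mul 2) fun p hp => ?_)).sub
      (((c6.pow 2).mul c1).div ((c3.pow 2).const_mul 4) fun p hp => ?_)
    all_goals
      have := hne p hp
      positivity
  · have hne : ∀ p ∈ Icc (0:ℝ) 1 ×ˢ Icc 0 t, 0 < ρ p.1 p.2 := fun p hp =>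
      hpos _ hp.1 _ (hsub _ hp.2)
    have hgc : ContinuousOn (fun p : ℝ × ℝ => g (ρ p.1 p.2)) (Icc (0:ℝ) 1 ×ˢ Icc 0 t) :=
      ContinuousOn.comp (t := Ioi 0)
        (fun r hr => (hgd r hr).continuousAt.continuousWithinAt) hsol.rho_cont.continuousOn hne
    refine (((hsol.rho_cont.mul (hsol.u_cont.pow 2)).div_const 2).continuousOn.add hgc).add
      ((hsol.rho_x_cont.pow 2).continuousOn.div (hsol.rho_cont.const_mul 4).continuousOn
        fun p hp => ?_)
    have := hne p hp
    positivity
  · intro x hx s hs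
    have hsT : s ∈ Ioo 0 T := ⟨hs.1, hs.2.trans_le ht.2⟩
    have hp := hpos x hx s (Ioo_subset_Icc_self hsT)
    have hr := hρt x hx s
    rw [hmass x hx s (Ioo_subset_Icc_self hsT)] at hr
    refine HasDerivAt.congr_deriv
      ((((hr.mul ((hut x hx s).fun_pow 2)).div_const 2).add ((hgd _ hp).comp s hr)).add
      (((hρxt x hx s hsT).fun_pow 2).fun_div (hr.const_mul 4) (by positivity))) ?_
    rw [hf]
    simp only [Nat.cast_ofNat]
    field_simp
    ring
  · intro s hs x hx
    have hs' := hsub s hs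
    have hp := hpos x hx s hs'
    have hr := hρx s hs' x
    refine HasDerivAt.congr_deriv
      (((hr.fun_mul (hux s hs' x)).fun_mul
      (((((hux s hs' x).fun_pow 2).div_const 2).fun_add ((hhd _ hp).comp x hr)).fun_sub (hQx s hs' x hp))).fun_add
      (((hρxx s hs' x).fun_mul (hax s hs' x)).fun_div (hr.const_mul 2) (by positivity))) ?_
    have h1 := hmom x hx s hs'
    rw [hf, hQ]
    have h2 : ρ x s * u x s * pdt u x s = u x s * (ρ x s * pdt u x s) := by ring
    rw [h2, h1, ha]
    simp only [Function.comp_apply]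
    field_simp
    ring
end

section
/- Let d ≥ 1, let Ω ⊂ ℝ^d be the open unit ball, and let P : [0,∞) → ℝ be C¹ with P ≥ 0. Let (ρ, u) be a classical solution of the d-dimensional QHD system on cl(Ω)×[0,T] with initial data ρ(·,0) = ρ_I > 0, u(·,0) = u_I, such that for every t ∈ [0,T] and every x with |x| = 1: (i) ∇√ρ(x,t)·x = 0, and (ii) −2(Δ√ρ/√ρ + |∇√ρ|²/ρ − P(ρ)/ρ)(x,t) + 2(u(x,t)·x)² = c for a constant c ≤ 0. If ∫_Ω ρ_I(x) (u_I(x)·x) dx > 0, then T ≤ T* := (∫_Ω (1−|x|²) ρ_I(x) dx) / (2 ∫_Ω ρ_I(x)(u_I(x)·x) dx). (Hence no classical solution with everywhere positive density exists beyond the finite time T*.) -/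
open MeasureTheory Real Set
open scoped BigOperators

/-- Partial derivative in the `j`-th coordinate direction of `ℝ^d`. -/
noncomputable def pd {d : ℕ} {F : Type*} [NormedAddCommGroup F] [NormedSpace ℝ F]
    (j : Fin d) (f : EuclideanSpace ℝ (Fin d) → F) (x : EuclideanSpace ℝ (Fin d)) : F :=
  fderiv ℝ f x (EuclideanSpace.single j 1)

/-- A classical solution of the `d`-dimensional quantum hydrodynamic system (with ε² = 2)
`ρ_t + div(ρu) = 0`, `(ρu)_t + div(ρu⊗u) + ∇P(ρ) = ρ∇(Δ√ρ/√ρ)` on `cl(Ω) × [0,T]`: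
`ρ > 0`, `ρ` of class `C¹` in `t` and `C³` in `x`, `u` of class `C¹` in `t` and `C²` in `x`,
all derivatives continuous up to the boundary, and both equations hold pointwise. -/
structure IsQHDSolutionMD (d : ℕ) (P : ℝ → ℝ) (Ω : Set (EuclideanSpace ℝ (Fin d)))
    (ρ : EuclideanSpace ℝ (Fin d) → ℝ → ℝ)
    (u : EuclideanSpace ℝ (Fin d) → ℝ → Fin d → ℝ) (T : ℝ) : Prop where
  pos : ∀ x ∈ closure Ω, ∀ t ∈ Set.Icc (0:ℝ) T, 0 < ρ x t
  rho_C3_x : ∀ t ∈ Set.Icc (0:ℝ) T, ContDiff ℝ 3 (fun x => ρ x t)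
  rho_C1_t : ∀ x ∈ closure Ω, ContDiff ℝ 1 (fun t => ρ x t)
  u_C2_x : ∀ t ∈ Set.Icc (0:ℝ) T, ∀ i : Fin d, ContDiff ℝ 2 (fun x => u x t i)
  u_C1_t : ∀ x ∈ closure Ω, ∀ i : Fin d, ContDiff ℝ 1 (fun t => u x t i)
  rho_cont : Continuous fun p : EuclideanSpace ℝ (Fin d) × ℝ => ρ p.1 p.2
  u_cont : ∀ i : Fin d, Continuous fun p : EuclideanSpace ℝ (Fin d) × ℝ => u p.1 p.2 i
  rho_t_cont : Continuous fun p : EuclideanSpace ℝ (Fin d) × ℝ => deriv (fun s => ρ p.1 s) p.2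
  u_t_cont : ∀ i : Fin d,
    Continuous fun p : EuclideanSpace ℝ (Fin d) × ℝ => deriv (fun s => u p.1 s i) p.2
  rho_x_cont : ∀ i : Fin d,
    Continuous fun p : EuclideanSpace ℝ (Fin d) × ℝ => pd i (fun y => ρ y p.2) p.1
  rho_xx_cont : ∀ i j : Fin d,
    Continuous fun p : EuclideanSpace ℝ (Fin d) × ℝ => pd i (pd j (fun y => ρ y p.2)) p.1
  rho_xxx_cont : ∀ i j k : Fin d,
    Continuous fun p : EuclideanSpace ℝ (Fin d) × ℝ =>
      pd i (pd j (pd k (fun y => ρ y p.2))) p.1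
  u_x_cont : ∀ i j : Fin d,
    Continuous fun p : EuclideanSpace ℝ (Fin d) × ℝ => pd i (fun y => u y p.2 j) p.1
  u_xx_cont : ∀ i j k : Fin d,
    Continuous fun p : EuclideanSpace ℝ (Fin d) × ℝ => pd i (pd j (fun y => u y p.2 k)) p.1
  mass : ∀ x ∈ closure Ω, ∀ t ∈ Set.Icc (0:ℝ) T,
    deriv (fun s => ρ x s) t + (∑ j : Fin d, pd j (fun y => ρ y t * u y t j) x) = 0
  momentum : ∀ x ∈ closure Ω, ∀ t ∈ Set.Icc (0:ℝ) T, ∀ i : Fin d,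
    deriv (fun s => ρ x s * u x s i) t
      + (∑ j : Fin d, pd j (fun y => ρ y t * u y t i * u y t j) x)
      + pd i (fun y => P (ρ y t)) x
      = ρ x t * pd i (fun y =>
          (∑ j : Fin d, pd j (pd j (fun z => Real.sqrt (ρ z t))) y)
            / Real.sqrt (ρ y t)) x


section PartialDerivatives

variable {d : ℕ} {x : EuclideanSpace ℝ (Fin d)} {f g : EuclideanSpace ℝ (Fin d) → ℝ}

lemma pd_add (j : Fin d) (hf : DifferentiableAt ℝ f x) (hg : DifferentiableAt ℝ g x) :
    pd j (fun y => f y + g y) x = pd j f x + pd j g x := by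
  simp [pd, fderiv_fun_add hf hg]

lemma pd_sub (j : Fin d) (hf : DifferentiableAt ℝ f x) (hg : DifferentiableAt ℝ g x) :
    pd j (fun y => f y - g y) x = pd j f x - pd j g x := by
  simp [pd, fderiv_fun_sub hf hg]

lemma pd_neg (j : Fin d) : pd j (fun y => -f y) x = -pd j f x := by
  simp [pd]

lemma pd_const_mul (j : Fin d) (c : ℝ) (hf : DifferentiableAt ℝ f x) :
    pd j (fun y => c * f y) x = c * pd j f x := by
  simp [pd, fderiv_const_mul hf]

lemma pd_mul (j : Fin d) (hf : DifferentiableAt ℝ f x) (hg : DifferentiableAt ℝ g x) :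
    pd j (fun y => f y * g y) x = pd j f x * g x + f x * pd j g x := by
  simp only [pd, fderiv_fun_mul hf hg, add_apply,
    smul_apply, smul_eq_mul]
  ring

lemma pd_sum {ι : Type*} (s : Finset ι) (j : Fin d)
    {F : ι → EuclideanSpace ℝ (Fin d) → ℝ} (hF : ∀ i ∈ s, DifferentiableAt ℝ (F i) x) :
    pd j (fun y => ∑ i ∈ s, F i y) x = ∑ i ∈ s, pd j (F i) x := by
  simp [pd, fderiv_fun_sum hF]

lemma pd_div (j : Fin d) (hf : DifferentiableAt ℝ f x) (hg : DifferentiableAt ℝ g x)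
    (h0 : g x ≠ 0) :
    pd j (fun y => f y / g y) x = (pd j f x * g x - f x * pd j g x) / g x ^ 2 := by
  have hmul : (fun y => f y / g y * g y) =ᶠ[nhds x] f := by
    filter_upwards [hg.continuousAt.eventually_ne h0] with y hy
    field_simp
  have hq : DifferentiableAt ℝ (fun y => f y / g y) x := by
    simp only [div_eq_mul_inv]
    exact hf.mul (hg.inv h0)
  have h := pd_mul j hq hg
  have h2 : pd j (fun y => f y / g y * g y) x = pd j f x := by
    simp only [pd, hmul.fderiv_eq]
  rw [h2] at h
  rw [h]
  field_simp
  ring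

lemma differentiableAt_coord (i : Fin d) :
    DifferentiableAt ℝ (fun y : EuclideanSpace ℝ (Fin d) => y i) x :=
  (EuclideanSpace.proj (𝕜 := ℝ) i).differentiableAt

lemma contDiff_coord {n : WithTop ℕ∞} (i : Fin d) :
    ContDiff ℝ n (fun y : EuclideanSpace ℝ (Fin d) => y i) :=
  (EuclideanSpace.proj (𝕜 := ℝ) i).contDiff

lemma pd_coord (i j : Fin d) :
    pd j (fun y : EuclideanSpace ℝ (Fin d) => y i) x = if i = j then 1 else 0 := by
  have h : fderiv ℝ (fun y : EuclideanSpace ℝ (Fin d) => y i) x = EuclideanSpace.proj i :=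
    (EuclideanSpace.proj (𝕜 := ℝ) i).fderiv
  simp [pd, h]

lemma contDiffOn_pd {U : Set (EuclideanSpace ℝ (Fin d))} {m n : WithTop ℕ∞} (hU : IsOpen U)
    (hf : ContDiffOn ℝ n f U) (hmn : m + 1 ≤ n) (j : Fin d) : ContDiffOn ℝ m (pd j f) U :=
  (hf.fderiv_of_isOpen hU hmn).clm_apply contDiffOn_const

lemma pd_comm (hf : ContDiffAt ℝ 2 f x) (i j : Fin d) :
    pd i (pd j f) x = pd j (pd i f) x := by
  have hd : DifferentiableAt ℝ (fderiv ℝ f) x :=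
    (hf.fderiv_right (m := 1) (by norm_num)).differentiableAt (by norm_num)
  have key (k l : Fin d) : pd k (pd l f) x
      = fderiv ℝ (fderiv ℝ f) x (EuclideanSpace.single k 1) (EuclideanSpace.single l 1) := by
    have : pd l f = fun y => fderiv ℝ f y (EuclideanSpace.single l 1) := rfl
    rw [this]
    simp [pd, fderiv_clm_apply hd (differentiableAt_const _)]
  rw [key, key]
  exact hf.isSymmSndFDerivAt (by simp) _ _

/-- Divergence of the contraction of a tensor field with the position vector. -/
lemma div_coord_contract {G : Fin d → Fin d → EuclideanSpace ℝ (Fin d) → ℝ}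
    (hG : ∀ i j, DifferentiableAt ℝ (G i j) x) :
    ∑ j, pd j (fun y => ∑ i, y i * G i j y) x
      = ∑ j, G j j x + ∑ i, x i * ∑ j, pd j (G i j) x := by
  have h (j : Fin d) : pd j (fun y => ∑ i, y i * G i j y) x
      = G j j x + ∑ i, x i * pd j (G i j) x := by
    rw [pd_sum _ _ fun i _ => (differentiableAt_coord i).fun_mul (hG i j)]
    simp_rw [pd_mul j (differentiableAt_coord _) (hG _ j), pd_coord]
    simp [Finset.sum_add_distrib]
  simp_rw [h, Finset.sum_add_distrib, Finset.mul_sum]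
  rw [Finset.sum_comm]

end PartialDerivatives

section Flux

variable {d : ℕ}

/-- A smooth radial cutoff, vanishing for `1 - ‖x‖² ≤ 1 / n` and equal to one for
`1 - ‖x‖² ≥ 2 / n`. -/
noncomputable def ballCutoff (n : ℝ) (x : EuclideanSpace ℝ (Fin d)) : ℝ :=
  Real.smoothTransition (n * (1 - ‖x‖ ^ 2) - 1)

lemma contDiff_ballCutoff (n : ℝ) :
    ContDiff ℝ 1 (ballCutoff n : EuclideanSpace ℝ (Fin d) → ℝ) :=
  (Real.smoothTransition.contDiff (n := 1)).comp
    ((contDiff_const.mul (contDiff_const.sub (contDiff_norm_sq ℝ))).sub contDiff_const)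

lemma pd_ballCutoff (n : ℝ) (j : Fin d) (x : EuclideanSpace ℝ (Fin d)) :
    pd j (ballCutoff n) x
      = deriv Real.smoothTransition (n * (1 - ‖x‖ ^ 2) - 1) * (-(2 * n) * x j) := by
  have h1 : HasFDerivAt (fun y : EuclideanSpace ℝ (Fin d) => n * (1 - ‖y‖ ^ 2) - 1)
      (n • -((2 : ℕ) • (innerSL ℝ x : EuclideanSpace ℝ (Fin d) →L[ℝ] ℝ)) :
        EuclideanSpace ℝ (Fin d) →L[ℝ] ℝ) x :=
    (((hasStrictFDerivAt_norm_sq x).hasFDerivAt.const_sub 1).const_mul n).sub_const 1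
  have h2 : HasDerivAt Real.smoothTransition
      (deriv Real.smoothTransition (n * (1 - ‖x‖ ^ 2) - 1)) (n * (1 - ‖x‖ ^ 2) - 1) :=
    ((Real.smoothTransition.contDiff (n := 1)).differentiable (by norm_num) _).hasDerivAt
  have h3 := (h2.comp_hasFDerivAt x h1).fderiv
  have h4 : fderiv ℝ (ballCutoff n) x = _ := h3
  rw [pd, h4]
  simp [EuclideanSpace.inner_single_right]
  ring_nf
  simp

lemma tsupport_ballCutoff_subset {n : ℝ} (hn : 0 < n) :
    tsupport (ballCutoff n : EuclideanSpace ℝ (Fin d) → ℝ) ⊆ Metric.ball 0 1 := by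
  have hsub : tsupport (ballCutoff n : EuclideanSpace ℝ (Fin d) → ℝ)
      ⊆ {x | 0 ≤ n * (1 - ‖x‖ ^ 2) - 1} := by
    refine closure_minimal (fun x hx => ?_) (isClosed_le continuous_const (by fun_prop))
    by_contra h
    exact hx (Real.smoothTransition.zero_of_nonpos (not_le.1 h).le)
  intro x hx
  have h := hsub hx
  simp only [mem_ofPred_eq] at h
  rw [mem_ball_zero_iff]
  by_contra! h1
  nlinarith [mul_nonneg hn.le (by nlinarith : 0 ≤ ‖x‖ ^ 2 - 1)]

lemma hasCompactSupport_ballCutoff {n : ℝ} (hn : 0 < n) :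
    HasCompactSupport (ballCutoff n : EuclideanSpace ℝ (Fin d) → ℝ) :=
  (isCompact_closedBall 0 1).of_isClosed_subset (isClosed_tsupport _)
    ((tsupport_ballCutoff_subset hn).trans Metric.ball_subset_closedBall)

lemma integrable_of_tsupport_subset {f : EuclideanSpace ℝ (Fin d) → ℝ}
    {K : Set (EuclideanSpace ℝ (Fin d))} (hK : IsCompact K) (hf : tsupport f ⊆ K)
    (hc : ∀ x ∈ K, ContinuousAt f x) : Integrable f :=
  (continuous_of_tsupport fun x hx => hc x (hf hx)).integrable_of_hasCompactSupport
    (hK.of_isClosed_subset (isClosed_tsupport _) hf)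

variable {U : Set (EuclideanSpace ℝ (Fin d))} {F : Fin d → EuclideanSpace ℝ (Fin d) → ℝ}

lemma integral_ballCutoff_mul_div {n : ℝ} (hn : 0 < n) (hU : IsOpen U)
    (hBU : Metric.closedBall 0 1 ⊆ U) (hF : ∀ j, ContDiffOn ℝ 1 (F j) U) :
    ∫ x, ballCutoff n x * ∑ j, pd j (F j) x
      = ∫ x, 2 * n * deriv Real.smoothTransition (n * (1 - ‖x‖ ^ 2) - 1) * ∑ j, F j x * x j := by
  have hK : tsupport (ballCutoff n) ⊆ U :=
    (tsupport_ballCutoff_subset hn).trans (Metric.ball_subset_closedBall.trans hBU)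
  have hcK := hasCompactSupport_ballCutoff (d := d) hn
  have hFa (j : Fin d) (x) (hx : x ∈ tsupport (ballCutoff n)) : ContDiffAt ℝ 1 (F j) x :=
    (hF j).contDiffAt (hU.mem_nhds (hK hx))
  have hpd (j : Fin d) (x) (hx : x ∈ tsupport (ballCutoff n)) : ContinuousAt (pd j (F j)) x :=
    ((contDiffOn_pd (m := 0) hU (hF j) (by norm_num) j).contDiffAt
      (hU.mem_nhds (hK hx))).continuousAt
  have hφ := contDiff_ballCutoff (d := d) n
  have hφc (j : Fin d) : Continuous (pd j (ballCutoff (d := d) n)) :=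
    (hφ.continuous_fderiv (by norm_num)).clm_apply continuous_const
  have hi1 (j : Fin d) : Integrable fun x => pd j (ballCutoff n) x * F j x := by
    refine integrable_of_tsupport_subset hcK ?_
      fun x hx => (hφc j).continuousAt.mul (hFa j x hx).continuousAt
    refine (tsupport_mul_subset_left (f := pd j (ballCutoff n))).trans ?_
    exact tsupport_fderiv_apply_subset ℝ _
  have hi2 (j : Fin d) : Integrable fun x => ballCutoff n x * pd j (F j) x :=
    integrable_of_tsupport_subset hcK tsupport_mul_subset_left
      fun x hx => hφ.continuous.continuousAt.mul (hpd j x hx)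
  have hi3 (j : Fin d) : Integrable fun x => ballCutoff n x * F j x :=
    integrable_of_tsupport_subset hcK tsupport_mul_subset_left
      fun x hx => hφ.continuous.continuousAt.mul (hFa j x hx).continuousAt
  have key (j : Fin d) : ∫ x, ballCutoff n x * pd j (F j) x
      = -∫ x, pd j (ballCutoff n) x * F j x :=
    integral_mul_fderiv_eq_neg_fderiv_mul_of_integrable (hi1 j) (hi2 j) (hi3 j)
      (fun x _ => hφ.differentiable (by norm_num) x)
      (fun x hx => (hFa j x hx).differentiableAt (by norm_num))
  simp_rw [Finset.mul_sum]
  rw [integral_finsetSum _ fun j _ => hi2 j]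
  simp_rw [key]
  rw [Finset.sum_neg_distrib, ← integral_finsetSum _ fun j _ => hi1 j, ← integral_neg]
  refine integral_congr_ae (.of_forall fun x => ?_)
  simp only [pd_ballCutoff, ← Finset.sum_neg_distrib]
  exact Finset.sum_congr rfl fun j _ => by ring

lemma continuousOn_divergence (hU : IsOpen U) (hF : ∀ j, ContDiffOn ℝ 1 (F j) U) :
    ContinuousOn (fun x => ∑ j, pd j (F j) x) U :=
  continuousOn_finsetSum _ fun j _ =>
    (contDiffOn_pd (m := 0) hU (hF j) (by norm_num) j).continuousOn

lemma integrableOn_ball_of_continuousOn {f : EuclideanSpace ℝ (Fin d) → ℝ}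
    (hf : ContinuousOn f (Metric.closedBall 0 1)) : IntegrableOn f (Metric.ball 0 1) :=
  (hf.integrableOn_compact (isCompact_closedBall 0 1)).mono_set Metric.ball_subset_closedBall

/-- A vector field pointing strictly outwards on the unit sphere has nonnegative total
divergence in the unit ball. -/
lemma integral_div_nonneg_of_flux_pos (hU : IsOpen U) (hBU : Metric.closedBall 0 1 ⊆ U)
    (hF : ∀ j, ContDiffOn ℝ 1 (F j) U)
    (hflux : ∀ x : EuclideanSpace ℝ (Fin d), ‖x‖ = 1 → 0 < ∑ j, F j x * x j) :
    0 ≤ ∫ x in Metric.ball 0 1, ∑ j, pd j (F j) x := by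
  obtain ⟨r, hr, hshell⟩ : ∃ r < (1 : ℝ), ∀ x : EuclideanSpace ℝ (Fin d),
      r < ‖x‖ → ‖x‖ ≤ 1 → 0 ≤ ∑ j, F j x * x j := by
    have hcont : ContinuousOn (fun x => ∑ j, F j x * x j)
        (Metric.closedBall (0 : EuclideanSpace ℝ (Fin d)) 1) :=
      continuousOn_finsetSum _ fun j _ =>
        ((hF j).continuousOn.mono hBU).mul (contDiff_coord (n := 0) j).continuous.continuousOn
    have hS : IsCompact (Metric.closedBall (0 : EuclideanSpace ℝ (Fin d)) 1 ∩
        (fun x => ∑ j, F j x * x j) ⁻¹' Set.Iic 0) :=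
      (isCompact_closedBall 0 1).of_isClosed_subset
        (hcont.preimage_isClosed_of_isClosed Metric.isClosed_closedBall isClosed_Iic)
        inter_subset_left
    rcases (Metric.closedBall (0 : EuclideanSpace ℝ (Fin d)) 1 ∩
        (fun x => ∑ j, F j x * x j) ⁻¹' Set.Iic 0).eq_empty_or_nonempty with he | hne
    · refine ⟨0, zero_lt_one, fun x _ hx => ?_⟩
      by_contra! h
      exact (he ▸ (⟨mem_closedBall_zero_iff.2 hx, h.le⟩ :
        x ∈ Metric.closedBall (0 : EuclideanSpace ℝ (Fin d)) 1 ∩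
        (fun x => ∑ j, F j x * x j) ⁻¹' Set.Iic 0) : x ∈ (∅ : Set _)).elim
    · obtain ⟨x₀, hx₀, hmax⟩ := hS.exists_isMaxOn hne continuous_norm.continuousOn
      refine ⟨‖x₀‖, lt_of_le_of_ne (mem_closedBall_zero_iff.1 hx₀.1) fun h => ?_,
        fun x hx hx1 => ?_⟩
      · exact (hflux x₀ h).not_ge hx₀.2
      · by_contra! h
        exact hx.not_ge (hmax ⟨mem_closedBall_zero_iff.2 hx1, h.le⟩)
  have hdiv := integrableOn_ball_of_continuousOn ((continuousOn_divergence hU hF).mono hBU)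
  have hlim : Filter.Tendsto (fun n : ℕ => ∫ x : EuclideanSpace ℝ (Fin d),
      ballCutoff (n : ℝ) x * ∑ j, pd j (F j) x) Filter.atTop
      (nhds (∫ x, (Metric.ball 0 1).indicator (fun x => ∑ j, pd j (F j) x) x)) := by
    have hzero {n : ℕ} {x : EuclideanSpace ℝ (Fin d)} (hx : x ∉ Metric.ball 0 1) :
        ballCutoff (n : ℝ) x = 0 := by
      refine Real.smoothTransition.zero_of_nonpos ?_
      rw [mem_ball_zero_iff, not_lt] at hx
      nlinarith [mul_nonneg n.cast_nonneg (by nlinarith : 0 ≤ ‖x‖ ^ 2 - 1)]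
    have heq (n : ℕ) : (fun x : EuclideanSpace ℝ (Fin d) =>
        ballCutoff (n : ℝ) x * ∑ j, pd j (F j) x) = fun x => ballCutoff (n : ℝ) x *
          (Metric.ball 0 1).indicator (fun x => ∑ j, pd j (F j) x) x := by
      funext x
      by_cases hx : x ∈ Metric.ball 0 1
      · rw [indicator_of_mem hx]
      · rw [hzero hx, zero_mul, zero_mul]
    have hind := (integrable_indicator_iff measurableSet_ball).2 hdiv
    simp_rw [heq]
    refine tendsto_integral_of_dominated_convergence _
      (fun n => ((contDiff_ballCutoff _).continuous.aestronglyMeasurable).mul hind.1) hind.norm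
      (fun n => .of_forall fun x => ?_) (.of_forall fun x => ?_)
    · rw [norm_mul]
      refine mul_le_of_le_one_left (norm_nonneg _) ?_
      rw [ballCutoff, Real.norm_of_nonneg (Real.smoothTransition.nonneg _)]
      exact Real.smoothTransition.le_one _
    · by_cases hx : x ∈ Metric.ball 0 1
      · refine tendsto_const_nhds.congr' ?_
        have hx1 : 0 < 1 - ‖x‖ ^ 2 := by
          have := mem_ball_zero_iff.1 hx
          nlinarith [norm_nonneg x]
        filter_upwards [(tendsto_natCast_atTop_atTop (R := ℝ)).eventually_ge_atTop
          (2 / (1 - ‖x‖ ^ 2))] with n hn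
        rw [div_le_iff₀ hx1] at hn
        rw [ballCutoff, Real.smoothTransition.one_of_one_le (by linarith), one_mul]
      · simp [indicator_of_notMem hx]
  rw [integral_indicator measurableSet_ball] at hlim
  refine ge_of_tendsto hlim ?_
  filter_upwards [(tendsto_natCast_atTop_atTop (R := ℝ)).eventually_ge_atTop
    (2 / (1 - max r 0 ^ 2)), (tendsto_natCast_atTop_atTop (R := ℝ)).eventually_gt_atTop 0]
    with n hn hn0
  rw [integral_ballCutoff_mul_div hn0 hU hBU hF]
  refine integral_nonneg fun x => ?_
  have hder : 0 ≤ deriv Real.smoothTransition ((n : ℝ) * (1 - ‖x‖ ^ 2) - 1) :=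
    Real.smoothTransition.monotone.deriv_nonneg
  have hr0 : 0 ≤ max r 0 := le_max_right _ _
  have hr1 : max r 0 < 1 := max_lt hr zero_lt_one
  rw [div_le_iff₀ (by nlinarith)] at hn
  by_cases h0 : ‖x‖ ≤ 1
  · by_cases h1 : max r 0 < ‖x‖
    · have := hshell x ((le_max_left _ _).trans_lt h1) h0
      simp only [Pi.zero_apply]
      positivity
    · have hle : ‖x‖ ^ 2 ≤ max r 0 ^ 2 := by
        have := norm_nonneg x
        gcongr
        exact not_lt.1 h1
      have hz : deriv Real.smoothTransition ((n : ℝ) * (1 - ‖x‖ ^ 2) - 1) = 0 := by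
        refine IsLocalMax.deriv_eq_zero (.of_forall fun y => ?_)
        refine (Real.smoothTransition.le_one y).trans
          (Real.smoothTransition.one_of_one_le ?_).ge
        nlinarith
      simp [hz]
  · have hz : deriv Real.smoothTransition ((n : ℝ) * (1 - ‖x‖ ^ 2) - 1) = 0 := by
      refine IsLocalMin.deriv_eq_zero (.of_forall fun y => ?_)
      refine (Real.smoothTransition.zero_of_nonpos ?_).le.trans
        (Real.smoothTransition.nonneg y)
      nlinarith [mul_nonneg hn0.le (by nlinarith : 0 ≤ ‖x‖ ^ 2 - 1)]
    simp [hz]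

/-- Divergence inequality: a vector field with nonnegative outward flux density on the unit
sphere has nonnegative total divergence in the unit ball. -/
lemma integral_div_nonneg (hU : IsOpen U) (hBU : Metric.closedBall 0 1 ⊆ U)
    (hF : ∀ j, ContDiffOn ℝ 1 (F j) U)
    (hflux : ∀ x : EuclideanSpace ℝ (Fin d), ‖x‖ = 1 → 0 ≤ ∑ j, F j x * x j) :
    0 ≤ ∫ x in Metric.ball 0 1, ∑ j, pd j (F j) x := by
  set V : ℝ := ∫ x in Metric.ball (0 : EuclideanSpace ℝ (Fin d)) 1, (d : ℝ) with hV
  have hVnn : 0 ≤ V := integral_nonneg fun x => d.cast_nonneg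
  have key (δ : ℝ) (hδ : 0 < δ) :
      0 ≤ (∫ x in Metric.ball 0 1, ∑ j, pd j (F j) x) + δ * V := by
    have h := integral_div_nonneg_of_flux_pos (F := fun j y => F j y + δ * y j) hU hBU
      (fun j => (hF j).add (contDiff_const.mul (contDiff_coord j)).contDiffOn) fun x hx => by
        have h1 : ∑ j, (F j x + δ * x j) * x j = ∑ j, F j x * x j + δ * ‖x‖ ^ 2 := by
          rw [EuclideanSpace.real_norm_sq_eq, Finset.mul_sum, ← Finset.sum_add_distrib]
          exact Finset.sum_congr rfl fun j _ => by ring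
        rw [h1, hx]
        linarith [hflux x hx]
    have h2 : ∫ x in Metric.ball 0 1, ∑ j, pd j (fun y => F j y + δ * y j) x
        = ∫ x in Metric.ball 0 1, ((∑ j, pd j (F j) x) + δ * d) := by
      refine setIntegral_congr_fun measurableSet_ball fun x hx => ?_
      have hxU := hU.mem_nhds (hBU (Metric.ball_subset_closedBall hx))
      have h3 (j : Fin d) : pd j (fun y => F j y + δ * y j) x = pd j (F j) x + δ := by
        rw [pd_add j (((hF j).contDiffAt hxU).differentiableAt (by norm_num))
          ((differentiableAt_coord j).const_mul δ), pd_const_mul j δ (differentiableAt_coord j),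
          pd_coord]
        simp
      simp [h3, Finset.sum_add_distrib, mul_comm]
    rw [h2, integral_add (integrableOn_ball_of_continuousOn ((continuousOn_divergence hU hF).mono hBU))
      (integrableOn_ball_of_continuousOn continuousOn_const), integral_const_mul] at h
    exact h
  by_contra! hneg
  have := key (-(∫ x in Metric.ball 0 1, ∑ j, pd j (F j) x) / (2 * (V + 1)))
    (div_pos (by linarith) (by linarith))
  have h4 : -(∫ x in Metric.ball 0 1, ∑ j, pd j (F j) x) / (2 * (V + 1)) * V
      ≤ -(∫ x in Metric.ball 0 1, ∑ j, pd j (F j) x) / 2 := by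
    rw [div_mul_eq_mul_div, div_le_div_iff₀ (by linarith) (by norm_num)]
    nlinarith
  linarith

lemma integral_div_eq_zero (hU : IsOpen U) (hBU : Metric.closedBall 0 1 ⊆ U)
    (hF : ∀ j, ContDiffOn ℝ 1 (F j) U)
    (hflux : ∀ x : EuclideanSpace ℝ (Fin d), ‖x‖ = 1 → ∑ j, F j x * x j = 0) :
    ∫ x in Metric.ball 0 1, ∑ j, pd j (F j) x = 0 := by
  refine le_antisymm ?_ (integral_div_nonneg hU hBU hF fun x hx => (hflux x hx).ge)
  have h := integral_div_nonneg (F := fun j y => -F j y) hU hBU (fun j => (hF j).neg)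
    fun x hx => by simp [neg_mul, hflux x hx]
  simp only [pd_neg, Finset.sum_neg_distrib, integral_neg] at h
  linarith

end Flux

section Momentum

variable {d : ℕ} {U : Set (EuclideanSpace ℝ (Fin d))} {w : EuclideanSpace ℝ (Fin d) → ℝ}

lemma ContDiffOn.differentiableAt_of_isOpen {n : WithTop ℕ∞} {f : EuclideanSpace ℝ (Fin d) → ℝ}
    {x : EuclideanSpace ℝ (Fin d)} (hf : ContDiffOn ℝ n f U) (hU : IsOpen U) (hn : n ≠ 0)
    (hx : x ∈ U) : DifferentiableAt ℝ f x :=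
  (hf.contDiffAt (hU.mem_nhds hx)).differentiableAt hn

/-- The quantum term `w² ∂ᵢ(Δw / w)` in divergence form. -/
lemma bohm_divergence_form (hU : IsOpen U) (hw : ContDiffOn ℝ 3 w U)
    {x : EuclideanSpace ℝ (Fin d)} (hx : x ∈ U) (h0 : w x ≠ 0) (i : Fin d) :
    w x ^ 2 * pd i (fun y => (∑ j, pd j (pd j w) y) / w y) x
      = pd i (fun y => w y * (∑ j, pd j (pd j w) y) + ∑ j, pd j w y ^ 2) x
        - 2 * ∑ j, pd j (fun y => pd i w y * pd j w y) x := by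
  have hw1 (j : Fin d) : ContDiffOn ℝ 2 (pd j w) U := contDiffOn_pd hU hw (by norm_num) j
  have hw2 (j : Fin d) : ContDiffOn ℝ 1 (pd j (pd j w)) U :=
    contDiffOn_pd hU (hw1 j) (by norm_num) j
  have dw : DifferentiableAt ℝ w x := hw.differentiableAt_of_isOpen hU (by norm_num) hx
  have dw1 (j : Fin d) : DifferentiableAt ℝ (pd j w) x :=
    (hw1 j).differentiableAt_of_isOpen hU (by norm_num) hx
  have dw2 (j : Fin d) : DifferentiableAt ℝ (pd j (pd j w)) x :=
    (hw2 j).differentiableAt_of_isOpen hU (by norm_num) hx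
  have dL : DifferentiableAt ℝ (fun y => ∑ j, pd j (pd j w) y) x :=
    DifferentiableAt.fun_sum fun j _ => dw2 j
  have dsq : DifferentiableAt ℝ (fun y => ∑ j, pd j w y * pd j w y) x :=
    DifferentiableAt.fun_sum fun j _ => (dw1 j).mul (dw1 j)
  have hsymm (j : Fin d) : pd j (pd i w) x = pd i (pd j w) x :=
    pd_comm ((hw.contDiffAt (hU.mem_nhds hx)).of_le (by norm_num)) j i
  simp_rw [pow_two (pd _ w _)]
  rw [pd_div i dL dw h0, pd_add i (dw.fun_mul dL) dsq, pd_mul i dw dL,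
    pd_sum _ i fun j _ => (dw1 j).fun_mul (dw1 j)]
  simp_rw [fun j => pd_mul j (dw1 i) (dw1 j), fun j => pd_mul i (dw1 j) (dw1 j), hsymm,
    Finset.sum_add_distrib, ← Finset.mul_sum]
  have hc : ∑ j, pd i (pd j w) x * pd j w x = ∑ j, pd j w x * pd i (pd j w) x :=
    Finset.sum_congr rfl fun j _ => mul_comm _ _
  rw [hc]
  field_simp
  ring

variable {P : ℝ → ℝ} {r : EuclideanSpace ℝ (Fin d) → ℝ}
  {v m : Fin d → EuclideanSpace ℝ (Fin d) → ℝ} {c : ℝ}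

/-- The total radial momentum production in the unit ball is nonnegative. -/
lemma integral_radial_momentum_nonneg (hP : ContDiffOn ℝ 1 P (Set.Ici 0))
    (hPnonneg : ∀ s ≥ (0 : ℝ), 0 ≤ P s) (hr : ContDiff ℝ 3 r) (hv : ∀ i, ContDiff ℝ 2 (v i))
    (hpos : ∀ x ∈ Metric.closedBall 0 1, 0 < r x)
    (hm : ∀ i, Continuous (m i))
    (hmom : ∀ x ∈ Metric.closedBall 0 1, ∀ i,
      m i x + (∑ j, pd j (fun y => r y * v i y * v j y) x) + pd i (fun y => P (r y)) x
        = r x * pd i (fun y => (∑ j, pd j (pd j fun z => √(r z)) y) / √(r y)) x)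
    (hc : c ≤ 0)
    (hNeumann : ∀ x : EuclideanSpace ℝ (Fin d), ‖x‖ = 1 →
      ∑ j, pd j (fun z => √(r z)) x * x j = 0)
    (hbc : ∀ x : EuclideanSpace ℝ (Fin d), ‖x‖ = 1 →
      -2 * ((∑ j, pd j (pd j fun z => √(r z)) x) / √(r x)
          + (∑ j, pd j (fun z => √(r z)) x ^ 2) / r x - P (r x) / r x)
        + 2 * (∑ j, v j x * x j) ^ 2 = c) :
    0 ≤ ∫ x in Metric.ball 0 1, ∑ i, x i * m i x := by
  set w : EuclideanSpace ℝ (Fin d) → ℝ := fun z => √(r z)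
  set U : Set (EuclideanSpace ℝ (Fin d)) := {x | 0 < r x}
  have hU : IsOpen U := isOpen_lt continuous_const hr.continuous
  have hBU : Metric.closedBall 0 1 ⊆ U := hpos
  have hw : ContDiffOn ℝ 3 w U := hr.contDiffOn.sqrt fun x hx => (ne_of_gt hx)
  have hw1 (j : Fin d) : ContDiffOn ℝ 2 (pd j w) U := contDiffOn_pd hU hw (by norm_num) j
  have hw1' (j : Fin d) : ContDiffOn ℝ 1 (pd j w) U := (hw1 j).of_le (by norm_num)
  have hw2 (j : Fin d) : ContDiffOn ℝ 1 (pd j (pd j w)) U :=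
    contDiffOn_pd hU (hw1 j) (by norm_num) j
  have hw' : ContDiffOn ℝ 1 w U := hw.of_le (by norm_num)
  set A : EuclideanSpace ℝ (Fin d) → ℝ :=
    fun y => w y * (∑ j, pd j (pd j w) y) + ∑ j, pd j w y ^ 2 with hA
  have hA1 : ContDiffOn ℝ 1 A U :=
    (hw'.mul (ContDiffOn.sum fun j _ => hw2 j)).add (ContDiffOn.sum fun j _ => (hw1' j).pow 2)
  have hPr : ContDiffOn ℝ 1 (fun y => P (r y)) U :=
    hP.comp (hr.of_le (by norm_num)).contDiffOn fun x hx =>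
      Set.mem_Ici.2 (le_of_lt (show 0 < r x from hx))
  have hrv (i j : Fin d) : ContDiffOn ℝ 1 (fun y => r y * v i y * v j y) U :=
    (((hr.of_le (by norm_num)).mul ((hv i).of_le (by norm_num))).mul
      ((hv j).of_le (by norm_num))).contDiffOn
  set G : Fin d → Fin d → EuclideanSpace ℝ (Fin d) → ℝ := fun i j y =>
    (if i = j then 1 else 0) * (A y - P (r y)) - 2 * (pd i w y * pd j w y)
      - r y * v i y * v j y with hGdef
  have hww (i j : Fin d) : ContDiffOn ℝ 1 (fun y => pd i w y * pd j w y) U :=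
    (hw1' i).mul (hw1' j)
  have hG (i j : Fin d) : ContDiffOn ℝ 1 (G i j) U :=
    ((contDiffOn_const.mul (hA1.sub hPr)).sub (contDiffOn_const.mul (hww i j))).sub (hrv i j)
  set F : Fin d → EuclideanSpace ℝ (Fin d) → ℝ := fun j y =>
    (∑ i, y i * G i j y) - d * (w y * pd j w y) with hFdef
  have hxG (j : Fin d) : ContDiffOn ℝ 1 (fun y => ∑ i, y i * G i j y) U :=
    ContDiffOn.sum fun i _ => (contDiff_coord i).contDiffOn.mul (hG i j)
  have hF (j : Fin d) : ContDiffOn ℝ 1 (F j) U :=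
    (hxG j).sub (contDiffOn_const.mul (hw'.mul (hw1' j)))
  have hwsq (x) (hx : x ∈ U) : w x ^ 2 = r x := Real.sq_sqrt (le_of_lt hx)
  have hwpos (x) (hx : x ∈ U) : 0 < w x := Real.sqrt_pos.2 hx
  have hdiv (x) (hx : x ∈ Metric.closedBall 0 1) :
      ∑ j, pd j (F j) x = ∑ i, x i * m i x
        - (d * P (r x) + 2 * ∑ j, pd j w x ^ 2 + r x * ∑ j, v j x ^ 2) := by
    have hxU := hBU hx
    have D {f : EuclideanSpace ℝ (Fin d) → ℝ} (hf : ContDiffOn ℝ 1 f U) :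
        DifferentiableAt ℝ f x := hf.differentiableAt_of_isOpen hU (by norm_num) hxU
    have hpdF (j : Fin d) : pd j (F j) x = pd j (fun y => ∑ i, y i * G i j y) x
        - d * (pd j w x * pd j w x + w x * pd j (pd j w) x) := by
      rw [hFdef, pd_sub j (D (hxG j)) ((D (hw'.mul (hw1' j))).const_mul _),
        pd_const_mul j _ (D (hw'.mul (hw1' j))), pd_mul j (D hw') (D (hw1' j))]
    have hpdG (i j : Fin d) : pd j (G i j) x
        = (if i = j then 1 else 0) * (pd j A x - pd j (fun y => P (r y)) x)
          - 2 * pd j (fun y => pd i w y * pd j w y) x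
          - pd j (fun y => r y * v i y * v j y) x := by
      have d1 := D (hA1.sub hPr)
      have d2 := D (hww i j)
      rw [hGdef, pd_sub j ((d1.const_mul _).fun_sub (d2.const_mul _)) (D (hrv i j)),
        pd_sub j (d1.const_mul _) (d2.const_mul _), pd_const_mul j _ d1, pd_const_mul j _ d2,
        pd_sub j (D hA1) (D hPr)]
    have hGm (i : Fin d) : ∑ j, pd j (G i j) x = m i x := by
      have hb := bohm_divergence_form hU hw hxU (hwpos x hxU).ne' i
      rw [hwsq x hxU] at hb
      have h := hmom x hx i
      rw [hb] at h
      simp_rw [hpdG, Finset.sum_sub_distrib, ← Finset.mul_sum]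
      simp only [ite_mul, one_mul, zero_mul, Finset.sum_ite_eq, Finset.mem_univ, if_true]
      linarith
    have htr : ∑ j, G j j x
        = d * (A x - P (r x)) - 2 * ∑ j, pd j w x ^ 2 - r x * ∑ j, v j x ^ 2 := by
      simp only [hGdef, if_true, one_mul, Finset.sum_sub_distrib, Finset.mul_sum,
        Finset.sum_const, Finset.card_univ, Fintype.card_fin, nsmul_eq_mul]
      simp only [pow_two, mul_assoc]
      ring
    simp_rw [hpdF, Finset.sum_sub_distrib, div_coord_contract fun i j => D (hG i j), hGm, htr,
      ← Finset.mul_sum, Finset.sum_add_distrib, ← Finset.mul_sum, hA, pow_two]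
    ring
  have hflux (x : EuclideanSpace ℝ (Fin d)) (hx : ‖x‖ = 1) : 0 ≤ ∑ j, F j x * x j := by
    have hxU : x ∈ U := hBU (mem_closedBall_zero_iff.2 hx.le)
    have hxr : 0 < r x := hxU
    have hN := hNeumann x hx
    have hsq : ∑ j, x j * x j = 1 := by
      have := EuclideanSpace.real_norm_sq_eq x
      rw [hx] at this
      simpa [pow_two] using this.symm
    have hFx : ∑ j, F j x * x j = (A x - P (r x)) * ∑ j, x j * x j
        - 2 * (∑ j, pd j w x * x j) ^ 2 - r x * (∑ j, v j x * x j) ^ 2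
        - d * w x * ∑ j, pd j w x * x j := by
      have h1 : ∑ j, (∑ i, x i * G i j x) * x j = (A x - P (r x)) * ∑ j, x j * x j
          - 2 * (∑ j, pd j w x * x j) ^ 2 - r x * (∑ j, v j x * x j) ^ 2 := by
        simp only [hGdef, pow_two, Finset.sum_mul, Finset.mul_sum]
        rw [Finset.sum_comm]
        simp_rw [mul_sub, sub_mul, Finset.sum_sub_distrib]
        congr 1
        · congr 1
          · congr 1 <;>
            · refine Finset.sum_congr rfl fun i _ => ?_
              simp
              ring
          · exact Finset.sum_congr rfl fun i _ => Finset.sum_congr rfl fun j _ => by ring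
        · exact Finset.sum_congr rfl fun i _ => Finset.sum_congr rfl fun j _ => by ring
      simp only [hFdef, sub_mul, Finset.sum_sub_distrib, h1]
      congr 1
      rw [Finset.mul_sum]
      exact Finset.sum_congr rfl fun j _ => by ring
    rw [hFx, hN, hsq]
    have hb := hbc x hx
    have hwx := hwpos x hxU
    have h2 := hwsq x hxU
    have hval : A x - P (r x) - r x * (∑ j, v j x * x j) ^ 2 = -c * r x / 2 := by
      rw [← hb]
      change A x - P (r x) - r x * (∑ j, v j x * x j) ^ 2
        = -(-2 * ((∑ j, pd j (pd j w) x) / w x + (∑ j, pd j w x ^ 2) / r x - P (r x) / r x)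
          + 2 * (∑ j, v j x * x j) ^ 2) * r x / 2
      have h3 : (∑ j, pd j (pd j w) x) / w x * r x = w x * ∑ j, pd j (pd j w) x := by
        rw [← h2]
        field_simp
      simp only [hA, ← h3]
      field_simp
      ring
    nlinarith
  refine (integral_div_nonneg hU hBU hF hflux).trans ?_
  refine setIntegral_mono_on
    (integrableOn_ball_of_continuousOn ((continuousOn_divergence hU hF).mono hBU))
    (integrableOn_ball_of_continuousOn (Continuous.continuousOn ?_)) measurableSet_ball
    fun x hx => ?_
  · exact continuous_finsetSum _ fun i _ => (contDiff_coord (n := 0) i).continuous.mul (hm i)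
  · have hxB := Metric.ball_subset_closedBall hx
    rw [hdiv x hxB]
    have h1 := hPnonneg _ (hpos x hxB).le
    have h2 := (hpos x hxB).le
    have h3 : 0 ≤ ∑ j, pd j w x ^ 2 := Finset.sum_nonneg fun j _ => sq_nonneg _
    have h4 : 0 ≤ ∑ j, v j x ^ 2 := Finset.sum_nonneg fun j _ => sq_nonneg _
    have : 0 ≤ d * P (r x) + 2 * ∑ j, pd j w x ^ 2 + r x * ∑ j, v j x ^ 2 := by positivity
    linarith

end Momentum

section Evolution

variable {d : ℕ}

lemma hasDerivAt_integral_ball {f f' : EuclideanSpace ℝ (Fin d) → ℝ → ℝ}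
    (hf : ∀ t, Continuous fun x => f x t)
    (hf' : Continuous fun p : EuclideanSpace ℝ (Fin d) × ℝ => f' p.1 p.2)
    (hderiv : ∀ x ∈ Metric.ball 0 1, ∀ t, HasDerivAt (f x) (f' x t) t) (t : ℝ) :
    HasDerivAt (fun s => ∫ x in Metric.ball 0 1, f x s) (∫ x in Metric.ball 0 1, f' x t) t := by
  obtain ⟨C, hC⟩ := ((isCompact_closedBall (0 : EuclideanSpace ℝ (Fin d)) 1).prod
    (isCompact_closedBall t 1)).exists_bound_of_continuousOn hf'.continuousOn
  have hf't : Continuous fun x => f' x t := hf'.comp (by fun_prop : Continuous fun x => (x, t))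
  refine (hasDerivAt_integral_of_dominated_loc_of_deriv_le
    (bound := fun _ => C) (F := fun s x => f x s) (F' := fun s x => f' x s)
    (Metric.closedBall_mem_nhds t one_pos)
    (.of_forall fun s => (hf s).aestronglyMeasurable)
    (integrableOn_ball_of_continuousOn (hf t).continuousOn) hf't.aestronglyMeasurable
    ?_ (integrableOn_ball_of_continuousOn continuousOn_const) ?_).2
  · exact (ae_restrict_mem measurableSet_ball).mono fun x hx s hs =>
      hC (x, s) ⟨Metric.ball_subset_closedBall hx, hs⟩
  · exact (ae_restrict_mem measurableSet_ball).mono fun x hx s _ => hderiv x hx s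

lemma pd_one_sub_norm_sq (j : Fin d) (x : EuclideanSpace ℝ (Fin d)) :
    pd j (fun y => 1 - ‖y‖ ^ 2) x = -2 * x j := by
  have h := ((hasStrictFDerivAt_norm_sq x).hasFDerivAt.const_sub 1).fderiv
  rw [pd, h]
  simp [EuclideanSpace.inner_single_right]

/-- Weighted mass balance: testing the continuity equation with `1 - ‖x‖²`. -/
lemma integral_weighted_mass {r q : EuclideanSpace ℝ (Fin d) → ℝ}
    {v : Fin d → EuclideanSpace ℝ (Fin d) → ℝ}
    (hr : ContDiff ℝ 1 r) (hv : ∀ i, ContDiff ℝ 1 (v i)) (hq : Continuous q)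
    (hmass : ∀ x ∈ Metric.closedBall 0 1, q x + ∑ j, pd j (fun y => r y * v j y) x = 0) :
    ∫ x in Metric.ball 0 1, (1 - ‖x‖ ^ 2) * q x
      = -2 * ∫ x in Metric.ball 0 1, r x * ∑ j, v j x * x j := by
  have hw : ContDiff ℝ 1 fun y : EuclideanSpace ℝ (Fin d) => 1 - ‖y‖ ^ 2 :=
    contDiff_const.sub (contDiff_norm_sq ℝ)
  have h := integral_div_eq_zero (F := fun j y => (1 - ‖y‖ ^ 2) * (r y * v j y)) isOpen_univ
    (subset_univ _) (fun j => (hw.mul (hr.mul (hv j))).contDiffOn) fun x hx => by simp [hx]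
  have hc : Continuous fun x => r x * ∑ j, v j x * x j :=
    hr.continuous.mul (continuous_finsetSum _ fun j _ =>
      (hv j).continuous.mul (contDiff_coord (n := 0) j).continuous)
  have h2 : ∫ x in Metric.ball 0 1, ∑ j, pd j (fun y => (1 - ‖y‖ ^ 2) * (r y * v j y)) x
      = ∫ x in Metric.ball 0 1,
        (-2 * (r x * ∑ j, v j x * x j) - (1 - ‖x‖ ^ 2) * q x) := by
    refine setIntegral_congr_fun measurableSet_ball fun x hx => ?_
    have hx' := hmass x (Metric.ball_subset_closedBall hx)
    have h3 (j : Fin d) := pd_mul (x := x) j (hw.differentiable (by norm_num) x)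
      ((hr.mul (hv j)).differentiable (by norm_num) x)
    simp only [Finset.mul_sum, fun j => h3 j, pd_one_sub_norm_sq, Finset.sum_add_distrib]
    rw [← Finset.mul_sum, eq_neg_of_add_eq_zero_right hx', mul_neg, ← sub_eq_add_neg]
    congr 1
    exact Finset.sum_congr rfl fun j _ => by ring
  have hwq : Continuous fun x => (1 - ‖x‖ ^ 2) * q x := hw.continuous.mul hq
  rw [h2, integral_sub (integrableOn_ball_of_continuousOn (hc.const_mul _).continuousOn)
    (integrableOn_ball_of_continuousOn hwq.continuousOn),
    integral_const_mul] at h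
  linarith

end Evolution

/-- Blow-up in finite time for the multi-dimensional QHD system on the unit ball with the
boundary conditions induced by the weight `a(x) = 1 − |x|²`: if
`∫_Ω ρ_I (u_I·x) dx > 0`, then the existence time `T` is at most
`T* = (∫_Ω (1−|x|²) ρ_I dx)/(2 ∫_Ω ρ_I (u_I·x) dx)`. -/
theorem qhd_md_blowup_ball
    (d : ℕ) (hd : 1 ≤ d)
    (P : ℝ → ℝ) (hP : ContDiffOn ℝ 1 P (Set.Ici 0)) (hPnonneg : ∀ r ≥ (0:ℝ), 0 ≤ P r)
    (Ω : Set (EuclideanSpace ℝ (Fin d))) (hΩ : Ω = Metric.ball (0 : EuclideanSpace ℝ (Fin d)) 1)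
    (T : ℝ) (hT : 0 ≤ T)
    (ρ : EuclideanSpace ℝ (Fin d) → ℝ → ℝ) (u : EuclideanSpace ℝ (Fin d) → ℝ → Fin d → ℝ)
    (ρI : EuclideanSpace ℝ (Fin d) → ℝ) (uI : EuclideanSpace ℝ (Fin d) → Fin d → ℝ)
    (hsol : IsQHDSolutionMD d P Ω ρ u T)
    (hρI : ∀ x ∈ closure Ω, ρ x 0 = ρI x)
    (hρIpos : ∀ x ∈ closure Ω, 0 < ρI x)
    (huI : ∀ x ∈ closure Ω, u x 0 = uI x)
    (c : ℝ) (hc : c ≤ 0)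
    -- boundary conditions on the unit sphere
    (hNeumann : ∀ t ∈ Set.Icc (0:ℝ) T, ∀ x : EuclideanSpace ℝ (Fin d), ‖x‖ = 1 →
      (∑ j : Fin d, pd j (fun z => Real.sqrt (ρ z t)) x * x j) = 0)
    (hbc : ∀ t ∈ Set.Icc (0:ℝ) T, ∀ x : EuclideanSpace ℝ (Fin d), ‖x‖ = 1 →
      -2 * ((∑ j : Fin d, pd j (pd j (fun z => Real.sqrt (ρ z t))) x) / Real.sqrt (ρ x t)
            + (∑ j : Fin d, (pd j (fun z => Real.sqrt (ρ z t)) x) ^ 2) / ρ x t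
            - P (ρ x t) / ρ x t)
        + 2 * (∑ j : Fin d, u x t j * x j) ^ 2 = c)
    (hinit : 0 < ∫ x in Ω, ρI x * (∑ j : Fin d, uI x j * x j)) :
    T ≤ (∫ x in Ω, (1 - ‖x‖ ^ 2) * ρI x)
        / (2 * ∫ x in Ω, ρI x * (∑ j : Fin d, uI x j * x j)) := by
  subst hΩ
  have hcl : closure (Metric.ball (0 : EuclideanSpace ℝ (Fin d)) 1) = Metric.closedBall 0 1 :=
    closure_ball 0 one_ne_zero
  have hball {x : EuclideanSpace ℝ (Fin d)} (hx : x ∈ Metric.ball 0 1) :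
      x ∈ closure (Metric.ball (0 : EuclideanSpace ℝ (Fin d)) 1) := subset_closure hx
  have hslice (t : ℝ) : Continuous fun x : EuclideanSpace ℝ (Fin d) => (x, t) := by fun_prop
  have hcoord (j : Fin d) : Continuous fun p : EuclideanSpace ℝ (Fin d) × ℝ => p.1 j :=
    (contDiff_coord (n := 0) j).continuous.comp continuous_fst
  have hρt {x} (hx : x ∈ closure (Metric.ball (0 : EuclideanSpace ℝ (Fin d)) 1)) (t : ℝ) :
      HasDerivAt (ρ x) (deriv (fun s => ρ x s) t) t :=
    ((hsol.rho_C1_t x hx).differentiable (by norm_num) t).hasDerivAt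
  have hut {x} (hx : x ∈ closure (Metric.ball (0 : EuclideanSpace ℝ (Fin d)) 1)) (i : Fin d)
      (t : ℝ) : HasDerivAt (fun s => u x s i) (deriv (fun s => u x s i) t) t :=
    ((hsol.u_C1_t x hx i).differentiable (by norm_num) t).hasDerivAt
  set m : Fin d → EuclideanSpace ℝ (Fin d) → ℝ → ℝ := fun i x t =>
    deriv (fun s => ρ x s) t * u x t i + ρ x t * deriv (fun s => u x s i) t with hm
  have hmc (i : Fin d) :
      Continuous fun p : EuclideanSpace ℝ (Fin d) × ℝ => m i p.1 p.2 :=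
    (hsol.rho_t_cont.mul (hsol.u_cont i)).add (hsol.rho_cont.mul (hsol.u_t_cont i))
  have hmd {x} (hx : x ∈ closure (Metric.ball (0 : EuclideanSpace ℝ (Fin d)) 1)) (i : Fin d)
      (t : ℝ) : HasDerivAt (fun s => ρ x s * u x s i) (m i x t) t :=
    (hρt hx t).mul (hut hx i t)
  set V : ℝ → ℝ := fun t => ∫ x in Metric.ball 0 1, ρ x t * ∑ j, u x t j * x j with hV
  set H : ℝ → ℝ := fun t => ∫ x in Metric.ball 0 1, (1 - ‖x‖ ^ 2) * ρ x t with hH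
  have hVderiv (t : ℝ) : HasDerivAt V (∫ x in Metric.ball 0 1, ∑ i, x i * m i x t) t := by
    refine hasDerivAt_integral_ball (f := fun x t => ρ x t * ∑ j, u x t j * x j)
      (f' := fun x t => ∑ i, x i * m i x t) (fun t => ?_)
      (continuous_finsetSum _ fun i _ => (hcoord i).mul (hmc i)) (fun x hx t => ?_) t
    · have h : Continuous fun p : EuclideanSpace ℝ (Fin d) × ℝ =>
          ρ p.1 p.2 * ∑ j, u p.1 p.2 j * p.1 j :=
        hsol.rho_cont.mul (continuous_finsetSum _ fun j _ => (hsol.u_cont j).mul (hcoord j))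
      exact h.comp (hslice t)
    · have h := HasDerivAt.fun_sum fun (i : Fin d) (_ : i ∈ Finset.univ) =>
        (hmd (hball hx) i t).const_mul (x i)
      refine h.congr_of_eventuallyEq (.of_forall fun s => ?_)
      simp only [Finset.mul_sum]
      exact Finset.sum_congr rfl fun i _ => by ring
  have hHderiv (t : ℝ) : HasDerivAt H
      (∫ x in Metric.ball 0 1, (1 - ‖x‖ ^ 2) * deriv (fun s => ρ x s) t) t := by
    refine hasDerivAt_integral_ball (f := fun x t => (1 - ‖x‖ ^ 2) * ρ x t)
      (f' := fun x t => (1 - ‖x‖ ^ 2) * deriv (fun s => ρ x s) t) (fun t => ?_) ?_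
      (fun x hx t => (hρt (hball hx) t).const_mul _) t
    · exact (continuous_const.sub (continuous_norm.pow 2)).mul (hsol.rho_cont.comp (hslice t))
    · exact (continuous_const.sub (continuous_fst.norm.pow 2)).mul hsol.rho_t_cont
  have hVnonneg (t) (ht : t ∈ Set.Icc 0 T) :
      0 ≤ ∫ x in Metric.ball 0 1, ∑ i, x i * m i x t := by
    refine integral_radial_momentum_nonneg (r := fun x => ρ x t) (v := fun i x => u x t i)
      (m := fun i x => m i x t) hP hPnonneg (hsol.rho_C3_x t ht) (hsol.u_C2_x t ht)
      (fun x hx => hsol.pos x (hcl ▸ hx) t ht) (fun i => (hmc i).comp (hslice t))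
      (fun x hx i => ?_) hc (hNeumann t ht) (hbc t ht)
    have hx' : x ∈ closure (Metric.ball (0 : EuclideanSpace ℝ (Fin d)) 1) := hcl ▸ hx
    rw [← hsol.momentum x hx' t ht i, (hmd hx' i t).deriv]
  have hHV (t) (ht : t ∈ Set.Icc 0 T) :
      ∫ x in Metric.ball 0 1, (1 - ‖x‖ ^ 2) * deriv (fun s => ρ x s) t = -2 * V t :=
    integral_weighted_mass (r := fun x => ρ x t) (v := fun i x => u x t i)
      ((hsol.rho_C3_x t ht).of_le (by norm_num))
      (fun i => (hsol.u_C2_x t ht i).of_le (by norm_num))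
      (hsol.rho_t_cont.comp (hslice t)) fun x hx => hsol.mass x (hcl ▸ hx) t ht
  have hVmono : MonotoneOn V (Set.Icc 0 T) :=
    monotoneOn_of_deriv_nonneg (convex_Icc 0 T)
      (fun t _ => (hVderiv t).continuousAt.continuousWithinAt)
      (fun t _ => (hVderiv t).differentiableAt.differentiableWithinAt) fun t ht => by
        rw [(hVderiv t).deriv]
        exact hVnonneg t (interior_subset ht)
  have h0T : (0 : ℝ) ∈ Set.Icc 0 T := ⟨le_rfl, hT⟩
  have hTT : T ∈ Set.Icc 0 T := ⟨hT, le_rfl⟩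
  have hHlin (t : ℝ) : HasDerivAt (fun s => H s + 2 * V 0 * s)
      ((∫ x in Metric.ball 0 1, (1 - ‖x‖ ^ 2) * deriv (fun s => ρ x s) t) + 2 * V 0) t := by
    simpa using (hHderiv t).fun_add ((hasDerivAt_id t).const_mul (2 * V 0))
  have hHanti : AntitoneOn (fun s => H s + 2 * V 0 * s) (Set.Icc 0 T) :=
    antitoneOn_of_deriv_nonpos (convex_Icc 0 T)
      (fun t _ => (hHlin t).continuousAt.continuousWithinAt)
      (fun t _ => (hHlin t).differentiableAt.differentiableWithinAt) fun t ht => by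
        have ht' := interior_subset ht
        rw [(hHlin t).deriv, hHV t ht']
        linarith [hVmono h0T ht' ht'.1]
  have hHT : 0 ≤ H T := by
    refine setIntegral_nonneg measurableSet_ball fun x hx => ?_
    have h1 := mem_ball_zero_iff.1 hx
    have h2 := norm_nonneg x
    exact mul_nonneg (by nlinarith) (hsol.pos x (hball hx) T hTT).le
  have hH0 : H 0 = ∫ x in Metric.ball 0 1, (1 - ‖x‖ ^ 2) * ρI x :=
    setIntegral_congr_fun measurableSet_ball fun x hx => by simp only [hρI x (hball hx)]
  have hV0 : V 0 = ∫ x in Metric.ball 0 1, ρI x * ∑ j, uI x j * x j :=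
    setIntegral_congr_fun measurableSet_ball fun x hx => by
      simp only [hρI x (hball hx), huI x (hball hx)]
  rw [← hV0] at hinit ⊢
  rw [← hH0, le_div_iff₀ (by linarith)]
  have := hHanti h0T hTT hT
  simp only at this
  linarith
end
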